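/- arXiv:2112.05308 — 3 statements merged into one kernel-verified Lean document; each statement's English description precedes it below -/
import Mathlib

section
/- Fix N ≥ 1, a probability vector p : Fin N → ℝ (pⱼ ≥ 0, Σⱼ pⱼ = 1), and reals ψ and χ : Fin N → ℝ. On the space Fin N × ℝ × ℝ let μ = Σⱼ pⱼ · (δⱼ ⊗ N(0,1) ⊗ N(0,1)), where δⱼ is the Dirac measure at j and N(0,1) is the standard normal law. Define Q = μ.withDensity of the function (j, z, u) ↦ exp(ψ·z + χⱼ·u − ψ²/2 − χⱼ²/2), and the map T(j, z, u) = (j, z − ψ, u − χⱼ). Then the pushforward of Q under T equals μ; that is, under the tilted (risk-neutral) measure Q, the transformed shocks z* = z − ψ and u* = u − χⱼ are independent standard normal random variables, independent of the state j, whose marginal law under Q is still p. -/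
open MeasureTheory ProbabilityTheory

lemma tilt_aux (a : ℝ) (f : ℝ → ENNReal) (hf : Measurable f) :
    ∫⁻ z, ENNReal.ofReal (Real.exp (a * z - a ^ 2 / 2)) * f (z - a) ∂(gaussianReal 0 1)
      = ∫⁻ z, f z ∂(gaussianReal 0 1) := by
  rw [gaussianReal_of_var_ne_zero 0 one_ne_zero,
    lintegral_withDensity_eq_lintegral_mul _ (measurable_gaussianPDF 0 1) (by fun_prop),
    lintegral_withDensity_eq_lintegral_mul _ (measurable_gaussianPDF 0 1) hf,
    ← lintegral_sub_right_eq_self (μ := volume) (gaussianPDF 0 1 * f) a]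
  refine lintegral_congr fun z => ?_
  simp only [Pi.mul_apply]
  rw [← mul_assoc]
  congr 1
  simp only [gaussianPDF]
  rw [← ENNReal.ofReal_mul (gaussianPDFReal_nonneg _ _ _)]
  congr 1
  simp only [gaussianPDFReal]
  rw [mul_assoc, ← Real.exp_add]
  congr 2
  push_cast
  ring

/-- Theorem 1 of the paper. On `Fin N × ℝ × ℝ`, with
`μ = ∑ⱼ pⱼ • (δⱼ ⊗ N(0,1) ⊗ N(0,1))` and the risk-neutral measure `Q` obtained from `μ`
by tilting with the state-dependent density `exp (ψ z + χⱼ u - ψ²/2 - χⱼ²/2)`,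
the pushforward of `Q` under `(j, z, u) ↦ (j, z - ψ, u - χⱼ)` equals `μ`; that is,
the transformed shocks are again i.i.d. standard normal, independent of the state,
and the state marginal is still `p`. -/
theorem stmt1 (N : ℕ) (hN : 1 ≤ N) (p : Fin N → ℝ)
    (hp : ∀ j, 0 ≤ p j) (hps : ∑ j, p j = 1)
    (ψ : ℝ) (χ : Fin N → ℝ)
    (μ : Measure (Fin N × ℝ × ℝ))
    (hμ : μ = ∑ j, ENNReal.ofReal (p j) •
      ((Measure.dirac j).prod ((gaussianReal 0 1).prod (gaussianReal 0 1))))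
    (Q : Measure (Fin N × ℝ × ℝ))
    (hQ : Q = μ.withDensity fun x =>
      ENNReal.ofReal
        (Real.exp (ψ * x.2.1 + χ x.1 * x.2.2 - ψ ^ 2 / 2 - (χ x.1) ^ 2 / 2))) :
    Measure.map (fun x : Fin N × ℝ × ℝ => (x.1, x.2.1 - ψ, x.2.2 - χ x.1)) Q = μ := by
  have hm : Measurable (fun x : Fin N × ℝ × ℝ => (x.1, x.2.1 - ψ, x.2.2 - χ x.1)) := by
    have : Measurable χ := measurable_of_finite χ
    fun_prop
  have hd : Measurable (fun x : Fin N × ℝ × ℝ => ENNReal.ofReal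
        (Real.exp (ψ * x.2.1 + χ x.1 * x.2.2 - ψ ^ 2 / 2 - (χ x.1) ^ 2 / 2))) := by
    have : Measurable χ := measurable_of_finite χ
    fun_prop
  refine Measure.ext_of_lintegral _ fun f hf => ?_
  have hfm : Measurable (fun x : Fin N × ℝ × ℝ => f (x.1, x.2.1 - ψ, x.2.2 - χ x.1)) :=
    hf.comp hm
  rw [lintegral_map hf hm, hQ, lintegral_withDensity_eq_lintegral_mul _ hd hfm, hμ,
    lintegral_finset_sum_measure, lintegral_finset_sum_measure]
  refine Finset.sum_congr rfl fun j _ => ?_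
  rw [lintegral_smul_measure, lintegral_smul_measure, Measure.dirac_prod,
    lintegral_map (hd.mul hfm) (by fun_prop), lintegral_map hf (by fun_prop),
    lintegral_prod _ (by
      exact ((hd.mul hfm).comp (measurable_prodMk_left (x := j))).aemeasurable),
    lintegral_prod _ (by fun_prop)]
  congr 1
  rw [← tilt_aux ψ (fun z => ∫⁻ u, f (j, z, u) ∂(gaussianReal 0 1))
    (Measurable.lintegral_prod_right (by fun_prop))]
  refine lintegral_congr fun z => ?_
  simp only [Pi.mul_apply]
  rw [← tilt_aux (χ j) (fun u => f (j, z - ψ, u)) (by fun_prop),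
    ← lintegral_const_mul _ (by fun_prop)]
  refine lintegral_congr fun u => ?_
  rw [← mul_assoc, ← ENNReal.ofReal_mul (Real.exp_nonneg _), ← Real.exp_add]
  congr 3
  ring
end

section
/- Let N ≥ 1, let π : Fin N → Fin N → ℝ be a row-stochastic matrix (π i j ≥ 0, Σⱼ π i j = 1), and define Δ(φ)(i) = log(Σⱼ π i j · exp(φ j)) for φ : Fin N → ℝ. Fix reals ρ, a, b, c, a vector ζ : Fin N → ℝ, an integer n ≥ 1 with 2·b·ρⁱ < 1 for all 0 ≤ i ≤ n−2, and let G(θ) = −(1/2)log(1 − 2θb) − θb + θ²a²/(2 − 4θb) + c²θ²/2, κₙ = Σ_{i=0}^{n−2} G(ρⁱ), and θ₁ = 0, θ_{m+1} = Δ(ρ^{m−1}·ζ + θ_m) for m ≥ 1. Then for every ℓ ∈ ℝ and every initial state i ∈ Fin N: Σ over all paths (j₀, …, j_{n−2}) ∈ (Fin N)^{n−1} of [π i j₀ · Π_{k=0}^{n−3} π jₖ jₖ₊₁] · ∫ exp(ρ^{n−1}·ℓ + Σ_{k=0}^{n−2} ρ^{n−2−k}·(ζ(jₖ) + a·zₖ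 + b·(zₖ² − 1) + c·uₖ)) d(⊗_{k=0}^{n−2} N(0,1) ⊗ N(0,1)) = exp(κₙ + ρ^{n−1}·ℓ + θₙ(i)), where the integral is over the i.i.d. standard normal shocks (z₀,u₀), …, (z_{n−2},u_{n−2}). -/
open MeasureTheory ProbabilityTheory

/-- The map `Δ(φ)(i) = log (∑ⱼ π i j exp (φ j))` from Corollary 1 of the paper. -/
noncomputable def Delta {N : ℕ} (π : Fin N → Fin N → ℝ) (φ : Fin N → ℝ) (i : Fin N) : ℝ :=
  Real.log (∑ j, π i j * Real.exp (φ j))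

lemma gauss_aux (p q r : ℝ) (hq : 2 * q < 1) :
    ∫ z, Real.exp (p * z + q * z ^ 2 + r) ∂(gaussianReal 0 1)
      = Real.exp (-(1 / 2) * Real.log (1 - 2 * q) + p ^ 2 / (2 - 4 * q) + r) := by
  rw [integral_gaussianReal_eq_integral_smul (by norm_num)]
  have hs : 0 < 1 / 2 - q := by linarith
  have hs2 : 0 < 1 - 2 * q := by linarith
  have h1 : ∀ z : ℝ, gaussianPDFReal 0 1 z • Real.exp (p * z + q * z ^ 2 + r)
      = ((√(2 * Real.pi))⁻¹ * Real.exp (p ^ 2 / (2 - 4 * q) + r)) *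
        Real.exp (-(1 / 2 - q) * (z - p / (1 - 2 * q)) ^ 2) := by
    intro z
    simp only [gaussianPDFReal, smul_eq_mul, NNReal.coe_one, mul_one, sub_zero]
    rw [mul_assoc, mul_assoc, ← Real.exp_add, ← Real.exp_add]
    congr 2
    have h3 : (2 - 4 * q) = 2 * (1 - 2 * q) := by ring
    rw [h3]
    field_simp
    ring
  simp_rw [h1]
  rw [integral_const_mul,
    integral_sub_right_eq_self (fun z : ℝ => Real.exp (-(1 / 2 - q) * z ^ 2)) (p / (1 - 2 * q)),
    integral_gaussian]
  have h2 : Real.exp (-(1 / 2) * Real.log (1 - 2 * q)) = (√(1 - 2 * q))⁻¹ := by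
    rw [Real.sqrt_eq_rpow, ← Real.rpow_neg hs2.le, Real.rpow_def_of_pos hs2]
    congr 1; ring
  have h4 : Real.pi / (1 / 2 - q) = (2 * Real.pi) / (1 - 2 * q) := by
    field_simp
  rw [add_assoc (-(1 / 2) * Real.log (1 - 2 * q)), Real.exp_add (-(1 / 2) * Real.log (1 - 2 * q)), h2, h4, Real.sqrt_div (by positivity)]
  have : √(2 * Real.pi) ≠ 0 := by positivity
  have : √(1 - 2 * q) ≠ 0 := by positivity
  field_simp

lemma shock_aux (t a b c s : ℝ) (h : 2 * t * b < 1) :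
    ∫ w : ℝ × ℝ, Real.exp (t * (s + a * w.1 + b * (w.1 ^ 2 - 1) + c * w.2))
      ∂((gaussianReal 0 1).prod (gaussianReal 0 1))
    = Real.exp (t * s) * Real.exp (-(1 / 2) * Real.log (1 - 2 * t * b) - t * b
        + t ^ 2 * a ^ 2 / (2 - 4 * t * b) + c ^ 2 * t ^ 2 / 2) := by
  have h1 : ∀ w : ℝ × ℝ, Real.exp (t * (s + a * w.1 + b * (w.1 ^ 2 - 1) + c * w.2))
     = Real.exp ((t * a) * w.1 + (t * b) * w.1 ^ 2 + (t * s - t * b)) *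
       Real.exp ((t * c) * w.2 + 0 * w.2 ^ 2 + 0) := by
    intro w
    rw [← Real.exp_add]; congr 1; ring
  simp_rw [h1]
  rw [integral_prod_mul (fun z : ℝ => Real.exp ((t * a) * z + (t * b) * z ^ 2 + (t * s - t * b)))
    (fun z : ℝ => Real.exp ((t * c) * z + 0 * z ^ 2 + 0)),
    gauss_aux _ _ _ (by linarith), gauss_aux _ _ _ (by norm_num), ← Real.exp_add, ← Real.exp_add]
  congr 1
  simp only [mul_zero, sub_zero, Real.log_one, ← mul_assoc]
  ring

lemma path_aux {N : ℕ} (π : Fin N → Fin N → ℝ)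
    (hπ0 : ∀ i j, 0 ≤ π i j) (hπ1 : ∀ i, ∑ j, π i j = 1) (ρ : ℝ) (ζ : Fin N → ℝ)
    (θfun : ℕ → Fin N → ℝ)
    (hθ1 : θfun 1 = 0)
    (hθrec : ∀ m, 1 ≤ m →
      θfun (m + 1) = Delta π (fun j => ρ ^ (m - 1) * ζ j + θfun m j)) (m : ℕ) :
    ∀ i : Fin N, ∑ j : Fin m → Fin N,
      (∏ k : Fin m, π (if (k : ℕ) = 0 then i
             else j ⟨(k : ℕ) - 1, by have := k.isLt; omega⟩) (j k)) *
        ∏ k : Fin m, Real.exp (ρ ^ (m - 1 - (k : ℕ)) * ζ (j k)) = Real.exp (θfun (m + 1) i) := by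
  induction m with
  | zero => intro i; simp [hθ1]
  | succ m ih =>
    intro i
    have hpos : 0 < ∑ j, π i j * Real.exp (ρ ^ m * ζ j + θfun (m + 1) j) := by
      have hnn : ∀ j ∈ Finset.univ, 0 ≤ π i j * Real.exp (ρ ^ m * ζ j + θfun (m + 1) j) :=
        fun j _ => mul_nonneg (hπ0 i j) (Real.exp_pos _).le
      refine lt_of_le_of_ne (Finset.sum_nonneg hnn) fun h0 => ?_
      have h := (Finset.sum_eq_zero_iff_of_nonneg hnn).1 h0.symm
      have : ∑ j, π i j = 0 := Finset.sum_eq_zero fun j hj => by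
        simpa using h j hj
      rw [hπ1] at this
      exact one_ne_zero this
    rw [hθrec (m + 1) (by omega), Delta]
    simp only [Nat.add_sub_cancel]
    rw [Real.exp_log hpos, ← (Fin.consEquiv (fun _ => Fin N)).sum_comp, Fintype.sum_prod_type]
    refine Finset.sum_congr rfl fun j0 _ => ?_
    rw [Real.exp_add, ← ih j0, Finset.mul_sum, Finset.mul_sum]
    refine Finset.sum_congr rfl fun j _ => ?_
    rw [Fin.prod_univ_succ, Fin.prod_univ_succ]
    have e1 : ∀ k : Fin m, m - ((k : ℕ) + 1) = m - 1 - k := fun k => by omega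
    have e2 : ∀ k : Fin m, (Fin.cons j0 j : Fin (m + 1) → Fin N) ⟨(k : ℕ), by omega⟩
        = if (k : ℕ) = 0 then j0 else j ⟨(k : ℕ) - 1, by omega⟩ := by
      intro k
      rcases k with ⟨_ | k, hk⟩
      · rfl
      · rfl
    simp only [Fin.consEquiv_apply, Fin.cons_zero, Fin.cons_succ, Fin.val_succ, Fin.val_zero,
      if_true, Nat.succ_ne_zero, if_false, Nat.add_sub_cancel, e1, e2, Nat.sub_zero]
    ring

/-- Corollary 1 of the paper as an explicit sum-integral identity:
`E_t^Q(h_{t+n} | s_t = e_i) = exp (κₙ + ρ^{n-1} ℓ + θₙ(i))` with `ℓ = log h_{t+1}`.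
The left side sums over all paths `(j₀, …, j_{n-2})` of the Markov chain started at `i`
the path probability times the expectation over the i.i.d. standard normal shocks
`(z₀,u₀), …, (z_{n-2},u_{n-2})` of
`exp (ρ^{n-1} ℓ + ∑ₖ ρ^{n-2-k} (ζ(jₖ) + a zₖ + b (zₖ² - 1) + c uₖ))`. -/
theorem stmt7 (N : ℕ) (hN : 1 ≤ N) (π : Fin N → Fin N → ℝ)
    (hπ0 : ∀ i j, 0 ≤ π i j) (hπ1 : ∀ i, ∑ j, π i j = 1)
    (ρ a b c : ℝ) (ζ : Fin N → ℝ) (n : ℕ) (hn : 1 ≤ n)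
    (hb : ∀ i : ℕ, i ≤ n - 2 → 2 * b * ρ ^ i < 1)
    (G : ℝ → ℝ)
    (hG : ∀ θ : ℝ, 2 * θ * b < 1 →
      G θ = -(1 / 2) * Real.log (1 - 2 * θ * b) - θ * b
        + θ ^ 2 * a ^ 2 / (2 - 4 * θ * b) + c ^ 2 * θ ^ 2 / 2)
    (κ : ℝ) (hκ : κ = ∑ i ∈ Finset.range (n - 1), G (ρ ^ i))
    (θfun : ℕ → Fin N → ℝ)
    (hθ1 : θfun 1 = 0)
    (hθrec : ∀ m, 1 ≤ m →
      θfun (m + 1) = Delta π (fun j => ρ ^ (m - 1) * ζ j + θfun m j))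
    (ℓ : ℝ) (i : Fin N) :
    ∑ j : Fin (n - 1) → Fin N,
      (∏ k : Fin (n - 1),
          π (if (k : ℕ) = 0 then i
             else j ⟨(k : ℕ) - 1, by have := k.isLt; omega⟩) (j k)) *
        ∫ w : Fin (n - 1) → ℝ × ℝ,
          Real.exp (ρ ^ (n - 1) * ℓ +
            ∑ k : Fin (n - 1), ρ ^ (n - 2 - (k : ℕ)) *
              (ζ (j k) + a * (w k).1 + b * ((w k).1 ^ 2 - 1) + c * (w k).2))
          ∂(Measure.pi fun _ : Fin (n - 1) =>
              (gaussianReal 0 1).prod (gaussianReal 0 1))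
      = Real.exp (κ + ρ ^ (n - 1) * ℓ + θfun n i) := by
  obtain ⟨m, rfl⟩ : ∃ m, n = m + 1 := ⟨n - 1, by omega⟩
  have hint : ∀ j : Fin m → Fin N, ∫ w : Fin m → ℝ × ℝ,
          Real.exp (ρ ^ m * ℓ +
            ∑ k : Fin m, ρ ^ (m - 1 - (k : ℕ)) *
              (ζ (j k) + a * (w k).1 + b * ((w k).1 ^ 2 - 1) + c * (w k).2))
          ∂(Measure.pi fun _ : Fin m =>
              (gaussianReal 0 1).prod (gaussianReal 0 1))
      = Real.exp (κ + ρ ^ m * ℓ) * ∏ k : Fin m, Real.exp (ρ ^ (m - 1 - (k : ℕ)) * ζ (j k)) := by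
    intro j
    simp_rw [Real.exp_add (ρ ^ m * ℓ), Real.exp_sum]
    rw [integral_const_mul, integral_fintype_prod_eq_prod (fun (k : Fin m) (w : ℝ × ℝ) =>
      Real.exp (ρ ^ (m - 1 - (k : ℕ)) *
              (ζ (j k) + a * w.1 + b * (w.1 ^ 2 - 1) + c * w.2)))]
    have h1 : ∀ k : Fin m, ∫ w : ℝ × ℝ, Real.exp (ρ ^ (m - 1 - (k : ℕ)) *
              (ζ (j k) + a * w.1 + b * (w.1 ^ 2 - 1) + c * w.2))
          ∂((gaussianReal 0 1).prod (gaussianReal 0 1)) =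
        Real.exp (ρ ^ (m - 1 - (k : ℕ)) * ζ (j k)) * Real.exp (G (ρ ^ (m - 1 - (k : ℕ)))) := by
      intro k
      have hlt : 2 * ρ ^ (m - 1 - (k : ℕ)) * b < 1 := by
        have := hb (m - 1 - (k : ℕ)) (by omega)
        linarith
      rw [shock_aux _ _ _ _ _ hlt, hG _ hlt]
    simp_rw [h1]
    rw [Finset.prod_mul_distrib, ← Real.exp_sum _ (fun k : Fin m => G _),
      Fin.sum_univ_eq_sum_range (fun k => G (ρ ^ (m - 1 - k))) m,
      Finset.sum_range_reflect (fun k => G (ρ ^ k)) m]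
    simp only [Nat.add_sub_cancel] at hκ
    rw [← hκ, Real.exp_add]
    ring
  have hp := path_aux π hπ0 hπ1 ρ ζ θfun hθ1 hθrec m i
  rw [Real.exp_add, ← hp, Finset.mul_sum]
  refine Finset.sum_congr rfl fun j _ => ?_
  refine (congrArg _ (hint j)).trans ?_
  exact mul_left_comm _ _ _
end

section
/- Let N ≥ 1, let π : Fin N → Fin N → ℝ be a row-stochastic matrix, and define Δ(φ)(i) = log(Σⱼ π i j · exp(φ j)). Fix reals ρ, a, b, c, m, a vector ζ : Fin N → ℝ, a vector φ : Fin N → ℝ, and an integer n ≥ 2 with 2·m·b·ρⁱ < 1 for all 0 ≤ i ≤ n−2. Let G(θ) = −(1/2)log(1 − 2θb) − θb + θ²a²/(2 − 4θb) + c²θ²/2 and define θ₂(m,φ) = Δ(G(m)·𝟙 + m·ζ + φ) and θ_{k+1}(m,φ) = Δ(G(m·ρ^{k−1})·𝟙 + m·ρ^{k−1}·ζ + θ_k(m,φ)) for k ≥ 2, where 𝟙 is the all-ones vector. Then for every h > 0 and initial state i ∈ Fin N: Σ over paths (j₀, …, j_{n−2}) ∈ (Fin N)^{n−1} of [π i j₀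 · Π_{k=0}^{n−3} π jₖ jₖ₊₁] · ∫ h^{m·ρ^{n−1}} · exp(Σ_{k=0}^{n−2} m·ρ^{n−2−k}·(ζ(jₖ) + a·zₖ + b·(zₖ² − 1) + c·uₖ) + φ(j_{n−2})) d(⊗ N(0,1) ⊗ N(0,1)) = h^{m·ρ^{n−1}} · exp(θₙ(m,φ)(i)), with the integral taken over i.i.d. standard normal shocks (zₖ, uₖ), k = 0, …, n−2. -/
open MeasureTheory ProbabilityTheory

theorem aux_gauss (p q : ℝ) (hp : 2 * p < 1) :
    ∫ z, Real.exp (p * z ^ 2 + q * z) ∂(gaussianReal 0 1)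
      = Real.exp (-(1 / 2) * Real.log (1 - 2 * p) + q ^ 2 / (2 - 4 * p)) := by
  have hd : 0 < 1 - 2 * p := by linarith
  have hd' : (1 - 2 * p) ≠ 0 := hd.ne'
  have hd2 : (2 - 4 * p) ≠ 0 := by linarith
  rw [integral_gaussianReal_eq_integral_smul one_ne_zero]
  have hfun : ∀ z : ℝ, gaussianPDFReal 0 1 z • Real.exp (p * z ^ 2 + q * z)
      = ((√(2 * Real.pi))⁻¹ * Real.exp (q ^ 2 / (2 - 4 * p))) *
        Real.exp (-((1 - 2 * p) / 2) * (z - q / (1 - 2 * p)) ^ 2) := by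
    intro z
    simp only [gaussianPDFReal, smul_eq_mul, NNReal.coe_one, mul_one, sub_zero]
    rw [mul_assoc, mul_assoc, ← Real.exp_add, ← Real.exp_add]
    congr 2
    have h4 : (2 - 4 * p) = 2 * (1 - 2 * p) := by ring
    rw [h4]
    field_simp
    ring
  simp_rw [hfun]
  rw [integral_const_mul,
    integral_sub_right_eq_self (fun z : ℝ => Real.exp (-((1 - 2 * p) / 2) * z ^ 2)),
    integral_gaussian, Real.exp_add]
  have hs : Real.exp (-(1 / 2) * Real.log (1 - 2 * p)) = (√(1 - 2 * p))⁻¹ := by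
    rw [Real.sqrt_eq_rpow, ← Real.rpow_neg hd.le, Real.rpow_def_of_pos hd]
    congr 1; ring
  have hpi : Real.pi / ((1 - 2 * p) / 2) = (2 * Real.pi) / (1 - 2 * p) := by
    field_simp
  rw [hs, hpi, Real.sqrt_div (by positivity)]
  have : √(2 * Real.pi) ≠ 0 := by positivity
  field_simp

theorem aux_gauss2 (θ a b c : ℝ) (hb : 2 * θ * b < 1) :
    ∫ w : ℝ × ℝ, Real.exp (θ * (a * w.1 + b * (w.1 ^ 2 - 1) + c * w.2))
        ∂((gaussianReal 0 1).prod (gaussianReal 0 1))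
      = Real.exp (-(1 / 2) * Real.log (1 - 2 * θ * b) - θ * b
        + θ ^ 2 * a ^ 2 / (2 - 4 * θ * b) + c ^ 2 * θ ^ 2 / 2) := by
  have h1 := aux_gauss (θ * b) (θ * a) (by linarith)
  have h2 := aux_gauss 0 (θ * c) (by norm_num)
  have hfun : ∀ w : ℝ × ℝ, Real.exp (θ * (a * w.1 + b * (w.1 ^ 2 - 1) + c * w.2))
      = Real.exp (-(θ * b)) * (Real.exp (θ * b * w.1 ^ 2 + θ * a * w.1) *
          Real.exp (0 * w.2 ^ 2 + θ * c * w.2)) := by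
    intro w
    rw [← Real.exp_add, ← Real.exp_add]
    congr 1; ring
  simp_rw [hfun]
  rw [integral_const_mul, integral_prod_mul
    (fun z : ℝ => Real.exp (θ * b * z ^ 2 + θ * a * z))
    (fun z : ℝ => Real.exp (0 * z ^ 2 + θ * c * z)), h1, h2,
    ← Real.exp_add, ← Real.exp_add]
  congr 1
  have e1 : 1 - 2 * (θ * b) = 1 - 2 * θ * b := by ring
  have e2 : 2 - 4 * (θ * b) = 2 - 4 * θ * b := by ring
  rw [e1, e2]
  norm_num
  ring

theorem aux_exp_Delta {N : ℕ} (π : Fin N → Fin N → ℝ)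
    (hπ0 : ∀ i j, 0 ≤ π i j) (hπ1 : ∀ i, ∑ j, π i j = 1) (φ : Fin N → ℝ) (i : Fin N) :
    Real.exp (Delta π φ i) = ∑ j, π i j * Real.exp (φ j) := by
  unfold Delta
  apply Real.exp_log
  have hnn : ∀ j ∈ Finset.univ, 0 ≤ π i j * Real.exp (φ j) :=
    fun j _ => mul_nonneg (hπ0 i j) (Real.exp_pos _).le
  refine lt_of_le_of_ne (Finset.sum_nonneg hnn) ?_
  intro h0
  have h1 := (Finset.sum_eq_zero_iff_of_nonneg hnn).1 h0.symm
  have h2 : ∑ j, π i j = 0 := by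
    apply Finset.sum_eq_zero
    intro j hj
    exact (mul_eq_zero.1 (h1 j hj)).resolve_right (Real.exp_pos _).ne'
  rw [hπ1] at h2
  exact one_ne_zero h2

theorem aux_path {N : ℕ} (π : Fin N → Fin N → ℝ)
    (φ : Fin N → ℝ) (g : ℕ → Fin N → ℝ) (T : ℕ → Fin N → ℝ)
    (h0 : ∀ i, T 0 i = ∑ j, π i j * (Real.exp (g 0 j) * Real.exp (φ j)))
    (hs : ∀ r i, T (r + 1) i = ∑ j, π i j * (Real.exp (g (r + 1) j) * T r j)) (r : ℕ) :
    ∀ i : Fin N, ∑ j : Fin (r + 1) → Fin N,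
      (∏ k : Fin (r + 1),
          π (if (k : ℕ) = 0 then i
             else j ⟨(k : ℕ) - 1, by have := k.isLt; omega⟩) (j k)) *
        ((∏ k : Fin (r + 1), Real.exp (g (r - (k : ℕ)) (j k))) *
          Real.exp (φ (j ⟨r, by omega⟩))) = T r i := by
  induction r with
  | zero =>
    intro i
    rw [h0, ← (Equiv.funUnique (Fin 1) (Fin N)).symm.sum_comp]
    simp
  | succ r ih =>
    intro i
    rw [hs, ← (Fin.consEquiv (fun _ : Fin (r + 2) => Fin N)).sum_comp, Fintype.sum_prod_type]
    refine Finset.sum_congr rfl fun x _ => ?_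
    rw [← ih x, Finset.mul_sum, Finset.mul_sum]
    refine Finset.sum_congr rfl fun j _ => ?_
    rw [Fin.prod_univ_succ, Fin.prod_univ_succ (n := r + 1)]
    have e1 : ∀ k : Fin (r + 1), (if ((k.succ : Fin (r + 2)) : ℕ) = 0 then i
        else (Fin.cons x j : Fin (r + 2) → Fin N)
          ⟨((k.succ : Fin (r + 2)) : ℕ) - 1, by have := k.isLt; simp⟩)
        = if (k : ℕ) = 0 then x else j ⟨(k : ℕ) - 1, by have := k.isLt; omega⟩ := by
      intro k
      rcases k with ⟨k, hk⟩
      cases k with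
      | zero => simp
      | succ k =>
        simp only [Fin.succ_mk, Nat.add_eq_zero_iff, one_ne_zero, and_false, if_false,
          Nat.add_sub_cancel]
        exact Fin.cons_succ (α := fun _ => Fin N) x j ⟨k, by omega⟩
    have e2 : (Fin.cons x j : Fin (r + 2) → Fin N) ⟨r + 1, by omega⟩ = j ⟨r, by omega⟩ :=
      Fin.cons_succ (α := fun _ => Fin N) x j ⟨r, by omega⟩
    simp only [Fin.consEquiv_apply, e1, e2, Fin.cons_succ, Fin.cons_zero, Fin.val_zero, if_true,
      Fin.val_succ, Nat.add_sub_add_right, Nat.sub_zero]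
    simp only [Fin.val_succ] at e1
    simp only [e1]
    ring


/-- the general identity
`Ψₙ(m, φ) = E_t^Q(h_{t+n}^m exp (φ' s_{t+n-1}) | s_t = e_i) = h^{m ρ^{n-1}} exp (θₙ(m,φ)(i))`
of Appendix A (with `h = h_{t+1}`), written as an explicit sum over paths
`(j₀, …, j_{n-2})` of the Markov chain started at `i` of the path probability times
the expectation over the i.i.d. standard normal shocks of
`h^{m ρ^{n-1}} exp (∑ₖ m ρ^{n-2-k} (ζ(jₖ) + a zₖ + b (zₖ² - 1) + c uₖ) + φ(j_{n-2}))`,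
where `θ₂(m,φ) = Δ(G(m) 𝟙 + m ζ + φ)` and
`θ_{k+1}(m,φ) = Δ(G(m ρ^{k-1}) 𝟙 + m ρ^{k-1} ζ + θ_k(m,φ))` for `k ≥ 2`. -/
theorem stmt8 (N : ℕ) (hN : 1 ≤ N) (π : Fin N → Fin N → ℝ)
    (hπ0 : ∀ i j, 0 ≤ π i j) (hπ1 : ∀ i, ∑ j, π i j = 1)
    (ρ a b c m : ℝ) (ζ φ : Fin N → ℝ) (n : ℕ) (hn : 2 ≤ n)
    (hb : ∀ i : ℕ, i ≤ n - 2 → 2 * m * b * ρ ^ i < 1)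
    (G : ℝ → ℝ)
    (hG : ∀ θ : ℝ, 2 * θ * b < 1 →
      G θ = -(1 / 2) * Real.log (1 - 2 * θ * b) - θ * b
        + θ ^ 2 * a ^ 2 / (2 - 4 * θ * b) + c ^ 2 * θ ^ 2 / 2)
    (θfun : ℕ → Fin N → ℝ)
    (hθ2 : θfun 2 = Delta π (fun j => G m + m * ζ j + φ j))
    (hθrec : ∀ k, 2 ≤ k →
      θfun (k + 1) = Delta π
        (fun j => G (m * ρ ^ (k - 1)) + m * ρ ^ (k - 1) * ζ j + θfun k j))
    (h : ℝ) (hh : 0 < h) (i : Fin N) :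
    ∑ j : Fin (n - 1) → Fin N,
      (∏ k : Fin (n - 1),
          π (if (k : ℕ) = 0 then i
             else j ⟨(k : ℕ) - 1, by have := k.isLt; omega⟩) (j k)) *
        ∫ w : Fin (n - 1) → ℝ × ℝ,
          h ^ (m * ρ ^ (n - 1)) *
            Real.exp ((∑ k : Fin (n - 1), m * ρ ^ (n - 2 - (k : ℕ)) *
                (ζ (j k) + a * (w k).1 + b * ((w k).1 ^ 2 - 1) + c * (w k).2))
              + φ (j ⟨n - 2, by omega⟩))
          ∂(Measure.pi fun _ : Fin (n - 1) =>
              (gaussianReal 0 1).prod (gaussianReal 0 1))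
      = h ^ (m * ρ ^ (n - 1)) * Real.exp (θfun n i) := by
  obtain ⟨r, rfl⟩ : ∃ r, n = r + 2 := ⟨n - 2, by omega⟩
  have hint : ∀ j : Fin (r + 1) → Fin N,
      ∫ w : Fin (r + 1) → ℝ × ℝ,
          h ^ (m * ρ ^ (r + 1)) *
            Real.exp ((∑ k : Fin (r + 1), m * ρ ^ (r - (k : ℕ)) *
                (ζ (j k) + a * (w k).1 + b * ((w k).1 ^ 2 - 1) + c * (w k).2))
              + φ (j ⟨r, by omega⟩))
          ∂(Measure.pi fun _ : Fin (r + 1) =>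
              (gaussianReal 0 1).prod (gaussianReal 0 1))
      = h ^ (m * ρ ^ (r + 1)) *
        ((∏ k : Fin (r + 1), Real.exp (G (m * ρ ^ (r - (k : ℕ))) +
            m * ρ ^ (r - (k : ℕ)) * ζ (j k))) * Real.exp (φ (j ⟨r, by omega⟩))) := by
    intro j
    rw [integral_const_mul]
    congr 1
    simp_rw [Real.exp_add, Real.exp_sum]
    rw [integral_mul_const]
    congr 1
    rw [integral_fintype_prod_eq_prod (𝕜 := ℝ) (fun (k : Fin (r + 1)) (w : ℝ × ℝ) =>
      Real.exp (m * ρ ^ (r - (k : ℕ)) *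
                (ζ (j k) + a * w.1 + b * (w.1 ^ 2 - 1) + c * w.2)))]
    refine Finset.prod_congr rfl fun k _ => ?_
    have hbk : 2 * (m * ρ ^ (r - (k : ℕ))) * b < 1 := by
      have := hb (r - (k : ℕ)) (by omega)
      linarith
    rw [hG _ hbk, ← aux_gauss2 _ a b c hbk, ← integral_mul_const]
    refine integral_congr_ae (Filter.Eventually.of_forall fun w => ?_)
    simp only
    rw [← Real.exp_add]
    congr 1; ring
  have hpath := aux_path π φ (fun l x => G (m * ρ ^ l) + m * ρ ^ l * ζ x)
    (fun l x => Real.exp (θfun (l + 2) x))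
    (by
      intro i
      simp only [Nat.zero_add, hθ2, aux_exp_Delta π hπ0 hπ1]
      refine Finset.sum_congr rfl fun x _ => ?_
      rw [← Real.exp_add]; simp)
    (by
      intro l i
      have := hθrec (l + 2) (by omega)
      rw [show l + 1 + 2 = l + 2 + 1 by ring, this, aux_exp_Delta π hπ0 hπ1]
      refine Finset.sum_congr rfl fun x _ => ?_
      rw [← Real.exp_add]; rfl) r i
  rw [← hpath, Finset.mul_sum]
  refine Finset.sum_congr rfl fun j _ => ?_
  refine Eq.trans (congrArg _ (hint j)) ?_
  simp only [Nat.add_sub_cancel, Nat.add_succ_sub_one]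
  ring
end
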